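/- Let k, m ≥ 0 with k + m ≤ n, let Z ∈ Mat^{>0}_{n,k+m}, and let W ∈ Gr_{k+m,n} be the column span of Z. Let V ∈ Gr≥0_{k,n}, set X := V^⊥ ∩ W and Y := Z̃(V) ∈ Gr_{k,k+m}. Then X has dimension m, and for any choices of matrix representatives of X and Y there is a nonzero real constant c such that p_I(X) = c · ⟨Y Z_I⟩ for every m-element subset I of [n]. -/

import Mathlib

noncomputable section

/-- The Pluecker coordinate of the full-rank `k x n` matrix `C` on the column set `S`
(the minor on the columns in `S`, taken in increasing order). -/
def pluck {k n : ℕ} (C : Matrix (Fin k) (Fin n) ℝ) (S : Finset (Fin n))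
    (h : S.card = k) : ℝ :=
  (C.submatrix id (fun t => ((S.orderIsoOfFin h) t).val)).det

/-- All maximal (`p x p`) minors of the `n x p` matrix `Z` are positive. -/
def posMaxMinors {n p : ℕ} (Z : Matrix (Fin n) (Fin p) ℝ) : Prop :=
  ∀ (S : Finset (Fin n)) (h : S.card = p),
    0 < (Z.submatrix (fun t => ((S.orderIsoOfFin h) t).val) id).det

/-- Twistor-type determinant: the determinant of the square matrix whose first
`k` rows are the rows of `Y` and whose last `m` rows are `u 0, ..., u (m-1)`. -/
def twist {k m : ℕ} (Y : Matrix (Fin k) (Fin (k + m)) ℝ)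
    (u : Fin m → Fin (k + m) → ℝ) : ℝ :=
  (Matrix.of (Fin.append (fun i => Y i) u)).det

/-- The orthogonal complement of `V` with respect to the standard
bilinear form on `Fin n → ℝ`. -/
def perpSub {n : ℕ} (V : Submodule ℝ (Fin n → ℝ)) : Submodule ℝ (Fin n → ℝ) where
  carrier := {w | ∀ v ∈ V, ∑ i, v i * w i = 0}
  zero_mem' := by intro v hv; simp
  add_mem' := by
    intro a b ha hb v hv
    have h1 := ha v hv
    have h2 := hb v hv
    have h3 : ∀ i, v i * (a + b) i = v i * a i + v i * b i := by
      intro i; simp [mul_add]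
    rw [Finset.sum_congr rfl (fun i _ => h3 i), Finset.sum_add_distrib, h1, h2, add_zero]
  smul_mem' := by
    intro c a ha v hv
    have h := ha v hv
    have h3 : ∀ i, v i * (c • a) i = c * (v i * a i) := by
      intro i; simp [smul_eq_mul]; ring
    rw [Finset.sum_congr rfl (fun i _ => h3 i), ← Finset.mul_sum, h, mul_zero]

open Matrix Finset

/-- For small `ε > 0`, inserting the vector `∑ j, (-ε) ^ j • z j` in the first slot of an alternating
map preserves positivity on increasing subfamilies of `z`. -/
lemma exists_curryLeft_pos {E : Type*} [AddCommGroup E] [Module ℝ E] {p n : ℕ} (hpn : p < n)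
    (φ : E [⋀^Fin (p + 1)]→ₗ[ℝ] ℝ) (z : Fin n → E)
    (hφ : ∀ f : Fin (p + 1) → Fin n, StrictMono f → 0 < φ (z ∘ f)) :
    ∃ y : E, ∀ f : Fin p → Fin n, StrictMono f → 0 < φ.curryLeft y (z ∘ f) := by
  suffices h : ∀ f : Fin p → Fin n, StrictMono f →
      ∀ᶠ ε : ℝ in nhdsWithin 0 (Set.Ioi 0),
        0 < φ.curryLeft (∑ j : Fin n, (-ε) ^ (j : ℕ) • z j) (z ∘ f) by
    have h' : ∀ᶠ ε : ℝ in nhdsWithin 0 (Set.Ioi 0), ∀ f : Fin p → Fin n, StrictMono f →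
        0 < φ.curryLeft (∑ j : Fin n, (-ε) ^ (j : ℕ) • z j) (z ∘ f) := by
      rw [Filter.eventually_all]
      intro f
      by_cases hf : StrictMono f
      · exact (h f hf).mono fun ε hε _ => hε
      · exact Filter.Eventually.of_forall fun ε h => absurd h hf
    obtain ⟨ε, hε⟩ := h'.exists
    exact ⟨_, hε⟩
  intro f hf
  obtain ⟨i, hlt, hgt⟩ : ∃ i : Fin (p + 1), (∀ t : Fin p, (t : ℕ) < i → (f t : ℕ) = t) ∧
      ∀ t : Fin p, (i : ℕ) ≤ t → (i : ℕ) < f t := by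
    have hex : ∃ i : ℕ, i = p ∨ ∃ h : i < p, (f ⟨i, h⟩ : ℕ) ≠ i := ⟨p, Or.inl rfl⟩
    classical
    have hle : Nat.find hex ≤ p := Nat.find_min' hex (Or.inl rfl)
    have hfle : ∀ (t : ℕ) (ht : t < p), t ≤ f ⟨t, ht⟩ := by
      intro t
      induction t with
      | zero => intro _; exact Nat.zero_le _
      | succ t ih =>
        intro ht
        have h1 := ih (by omega)
        have h2 : f ⟨t, by omega⟩ < f ⟨t + 1, ht⟩ := hf (by simp [Fin.lt_def])
        rw [Fin.lt_def] at h2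
        omega
    refine ⟨⟨Nat.find hex, by omega⟩, ?_, ?_⟩
    · intro t ht
      have := Nat.find_min hex ht
      push Not at this
      exact this.2 t.2
    · intro t ht
      simp only at ht ⊢
      rcases Nat.find_spec hex with h | ⟨h, hne⟩
      · have := t.2
        omega
      · have h1 := hfle _ h
        have h2 : f ⟨Nat.find hex, h⟩ ≤ f t := hf.monotone (by simpa [Fin.le_def] using ht)
        rw [Fin.le_def] at h2
        omega
  let d : Fin n → ℝ := fun j => φ.curryLeft (z j) (z ∘ f)
  let j₀ : Fin n := ⟨i, by omega⟩
  have hd0 : ∀ j : Fin n, (j : ℕ) < i → d j = 0 := by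
    intro j hj
    have hjp : (j : ℕ) < p := by omega
    have hfj : f ⟨j, hjp⟩ = j := Fin.ext (hlt ⟨j, hjp⟩ hj)
    refine φ.map_eq_zero_of_eq _ (i := 0) (j := (Fin.succ ⟨j, hjp⟩)) ?_ (Fin.succ_ne_zero _).symm
    change z j = z (f ⟨j, hjp⟩)
    rw [hfj]
  have hd1 : 0 < (-1) ^ (i : ℕ) * d j₀ := by
    have hmono : StrictMono (i.insertNth j₀ f : Fin (p + 1) → Fin n) := by
      rw [Fin.strictMono_insertNth_iff]
      refine ⟨hf, fun t ht => ?_, fun t ht => hgt t ht⟩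
      have h : (t : ℕ) < i := ht
      rw [Fin.lt_def, hlt t h]
      exact h
    have h1 := hφ _ hmono
    have h2 : z ∘ (i.insertNth j₀ f : Fin (p + 1) → Fin n)
        = (Fin.cons (z j₀) (z ∘ f) : Fin (p + 1) → E) ∘ i.cycleRange := by
      rw [Fin.cons_comp_cycleRange]
      funext t
      refine Fin.succAboveCases i ?_ (fun t => ?_) t <;> simp
    rw [h2, AlternatingMap.map_perm, Fin.sign_cycleRange] at h1
    simpa [d, Units.smul_def, Matrix.vecCons] using h1
  have hsum : ∀ ε : ℝ, φ.curryLeft (∑ j : Fin n, (-ε) ^ (j : ℕ) • z j) (z ∘ f)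
      = ε ^ (i : ℕ) * ∑ j : Fin n, (-1) ^ (j : ℕ) * ε ^ ((j : ℕ) - i) * d j := by
    intro ε
    have : φ.curryLeft (∑ j : Fin n, (-ε) ^ (j : ℕ) • z j) (z ∘ f)
        = ∑ j : Fin n, (-ε) ^ (j : ℕ) * d j := by
      let ev : E →ₗ[ℝ] ℝ :=
        { toFun := fun y => φ.curryLeft y (z ∘ f)
          map_add' := fun a b => by simp only [map_add]; rfl
          map_smul' := fun a b => by simp only [map_smul]; rfl }
      change ev _ = ∑ j : Fin n, (-ε) ^ (j : ℕ) * ev (z j)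
      simp only [map_sum, map_smul, smul_eq_mul]
    rw [this, mul_sum]
    refine sum_congr rfl fun j _ => ?_
    rcases lt_or_ge (j : ℕ) i with h | h
    · simp [hd0 j h]
    · rw [neg_pow]
      conv_lhs => rw [← Nat.add_sub_cancel' h, pow_add ε]
      rw [Nat.add_sub_cancel' h]
      ring
  have hcont : Continuous fun ε : ℝ =>
      ∑ j : Fin n, (-1) ^ (j : ℕ) * ε ^ ((j : ℕ) - i) * d j := by fun_prop
  have hzero : 0 < ∑ j : Fin n, (-1) ^ (j : ℕ) * (0 : ℝ) ^ ((j : ℕ) - i) * d j := by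
    rw [sum_eq_single j₀]
    · simpa [j₀] using hd1
    · intro j _ hj
      rcases lt_or_ge (j : ℕ) i with h | h
      · simp [hd0 j h]
      · have : (j : ℕ) ≠ i := fun h => hj (Fin.ext h)
        rw [zero_pow (by omega)]
        simp
    · simp
  have hev := (hcont.tendsto 0).eventually (lt_mem_nhds hzero)
  filter_upwards [nhdsWithin_le_nhds hev, self_mem_nhdsWithin] with ε h1 h2
  rw [hsum]
  exact mul_pos (pow_pos h2 _) h1

/-- A family on which some alternating form of degree `k + m` is positive on increasing subfamilies
also admits such a form of degree `k`. -/
lemma exists_alternating_pos {E : Type*} [AddCommGroup E] [Module ℝ E] {k n : ℕ} (z : Fin n → E) :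
    ∀ m : ℕ, k + m ≤ n → ∀ φ : E [⋀^Fin (k + m)]→ₗ[ℝ] ℝ,
      (∀ f : Fin (k + m) → Fin n, StrictMono f → 0 < φ (z ∘ f)) →
      ∃ ψ : E [⋀^Fin k]→ₗ[ℝ] ℝ, ∀ f : Fin k → Fin n, StrictMono f → 0 < ψ (z ∘ f)
  | 0, _, φ, hφ => ⟨φ, hφ⟩
  | m + 1, hm, φ, hφ => by
    obtain ⟨y, hy⟩ := exists_curryLeft_pos (p := k + m) (by omega) φ z hφ
    exact exists_alternating_pos z m (by omega) (φ.curryLeft y) hy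

/-- A form of the Cauchy–Binet formula, summed over all families of indices. -/
lemma factorial_mul_alternating_mul {E : Type*} [AddCommGroup E] [Module ℝ E] {k n : ℕ}
    (ψ : E [⋀^Fin k]→ₗ[ℝ] ℝ) (C : Matrix (Fin k) (Fin n) ℝ) (z : Fin n → E) :
    (k.factorial : ℝ) * ψ (fun i => ∑ j, C i j • z j)
      = ∑ f : Fin k → Fin n, (C.submatrix id f).det * ψ (z ∘ f) := by
  have hexp : ψ (fun i => ∑ j, C i j • z j) =
      ∑ f : Fin k → Fin n, (∏ i, C i (f i)) * ψ (z ∘ f) := by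
    have h := ψ.toMultilinearMap.map_sum (fun i j => C i j • z j)
    refine h.trans (sum_congr rfl fun f _ => ?_)
    exact ψ.toMultilinearMap.map_smul_univ (fun i => C i (f i)) (z ∘ f)
  have hperm : ∀ σ : Equiv.Perm (Fin k),
      ∑ f : Fin k → Fin n, ((Equiv.Perm.sign σ : ℤ) : ℝ) * (∏ i, C i (f (σ i))) * ψ (z ∘ f)
        = ψ (fun i => ∑ j, C i j • z j) := by
    intro σ
    rw [hexp]
    refine Fintype.sum_equiv (Equiv.arrowCongr σ.symm (Equiv.refl _)) _ _ fun f => ?_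
    have h : ψ (z ∘ f ∘ σ) = ((Equiv.Perm.sign σ : ℤ) : ℝ) * ψ (z ∘ f) := by
      rw [← Function.comp_assoc, ψ.map_perm, Units.smul_def, zsmul_eq_mul]
    have h' : (Equiv.arrowCongr σ.symm (Equiv.refl (Fin n))) f = f ∘ σ := by
      ext; simp
    rw [h', h]
    simp only [Function.comp_apply]
    ring
  simp_rw [← det_transpose (C.submatrix id _), det_apply', sum_mul]
  rw [sum_comm]
  simp only [transpose_apply, submatrix_apply, id]
  rw [sum_congr rfl fun σ _ => hperm σ]
  simp [Fintype.card_perm]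

lemma exists_perm_strictMono {α : Type*} [LinearOrder α] {k : ℕ} {f : Fin k → α}
    (hf : Function.Injective f) : ∃ σ : Equiv.Perm (Fin k), StrictMono (f ∘ σ) :=
  ⟨Tuple.sort f, (Tuple.monotone_sort f).strictMono_of_injective
    (hf.comp (Equiv.injective _))⟩

lemma coe_orderIsoOfFin_image {n k : ℕ} {f : Fin k → Fin n} (hf : StrictMono f)
    (h : (univ.image f).card = k) :
    (fun t => (((univ.image f).orderIsoOfFin h) t).val) = f := by
  exact (orderEmbOfFin_unique h (f := f) (by simp) hf).symm

lemma det_mul_alternating_comp_perm {E : Type*} [AddCommGroup E] [Module ℝ E] {k n : ℕ}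
    (ψ : E [⋀^Fin k]→ₗ[ℝ] ℝ) (C : Matrix (Fin k) (Fin n) ℝ) (z : Fin n → E)
    (f : Fin k → Fin n) (σ : Equiv.Perm (Fin k)) :
    (C.submatrix id (f ∘ σ)).det * ψ (z ∘ f ∘ σ) = (C.submatrix id f).det * ψ (z ∘ f) := by
  have h1 : (C.submatrix id (f ∘ σ)).det = ((Equiv.Perm.sign σ : ℤ) : ℝ) *
      (C.submatrix id f).det := det_permute' σ (C.submatrix id f)
  have h2 : ψ (z ∘ f ∘ σ) = ((Equiv.Perm.sign σ : ℤ) : ℝ) * ψ (z ∘ f) := by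
    rw [← Function.comp_assoc, ψ.map_perm, Units.smul_def, zsmul_eq_mul]
  rw [h1, h2]
  rcases Int.units_eq_one_or (Equiv.Perm.sign σ) with h | h <;> simp [h]

lemma det_mul_transpose_self_ne_zero {k N : ℕ} {A : Matrix (Fin k) (Fin N) ℝ}
    (hA : LinearIndependent ℝ A.row) : (A * Aᵀ).det ≠ 0 := by
  have h := (PosDef.mul_conjTranspose_self A (vecMul_injective_iff.2 hA)).det_pos
  rw [conjTranspose_eq_transpose_of_trivial] at h
  exact h.ne'

lemma exists_det_submatrix_ne_zero {k n : ℕ} {C : Matrix (Fin k) (Fin n) ℝ}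
    (hC : LinearIndependent ℝ C.row) : ∃ f : Fin k → Fin n, (C.submatrix id f).det ≠ 0 := by
  by_contra! h
  have h1 := factorial_mul_alternating_mul detRowAlternating C Cᵀ
  have h2 : (fun i => ∑ j, C i j • Cᵀ j) = C * Cᵀ := by
    ext i l
    simp [mul_apply]
  rw [h2] at h1
  have h3 : (k.factorial : ℝ) * (C * Cᵀ).det = 0 :=
    h1.trans (sum_eq_zero fun f _ => by rw [h f, zero_mul])
  exact mul_ne_zero (by positivity) (det_mul_transpose_self_ne_zero hC) h3

/-- A totally nonnegative subspace maps injectively under a matrix with positive maximal minors. -/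
lemma linearIndependent_mul_of_posMaxMinors {k m n : ℕ} (hkm : k + m ≤ n)
    {Z : Matrix (Fin n) (Fin (k + m)) ℝ} (hZ : posMaxMinors Z)
    {C : Matrix (Fin k) (Fin n) ℝ} (hC : LinearIndependent ℝ C.row)
    (hCnn : ∃ ε : ℝ, (ε = 1 ∨ ε = -1) ∧
      ∀ (S : Finset (Fin n)) (h : S.card = k), 0 ≤ ε * pluck C S h) :
    LinearIndependent ℝ (C * Z).row := by
  obtain ⟨ε, hε, hCnn⟩ := hCnn
  obtain ⟨ψ, hψ⟩ := exists_alternating_pos (fun i => Z i) m hkm detRowAlternating (by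
    intro f hf
    have hcard : (univ.image f).card = k + m := by
      rw [card_image_of_injective _ hf.injective]; simp
    have := hZ _ hcard
    rwa [coe_orderIsoOfFin_image hf hcard] at this)
  have hmono : ∀ f : Fin k → Fin n, StrictMono f → 0 ≤ ε * (C.submatrix id f).det := by
    intro f hf
    have hcard : (univ.image f).card = k := by
      rw [card_image_of_injective _ hf.injective]; simp
    have := hCnn _ hcard
    rwa [pluck, coe_orderIsoOfFin_image hf hcard] at this
  have hnn : ∀ f : Fin k → Fin n,
      0 ≤ ε * ((C.submatrix id f).det * ψ ((fun i => Z i) ∘ f)) := by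
    intro f
    by_cases hf : Function.Injective f
    · obtain ⟨σ, hσ⟩ := exists_perm_strictMono hf
      rw [← det_mul_alternating_comp_perm ψ C _ f σ, ← mul_assoc]
      exact mul_nonneg (hmono _ hσ) (hψ _ hσ).le
    · rw [Function.not_injective_iff] at hf
      obtain ⟨a, b, hab, hne⟩ := hf
      rw [ψ.map_eq_zero_of_eq _ (by simp [hab]) hne]
      simp
  obtain ⟨f, hf⟩ := exists_det_submatrix_ne_zero hC
  have hfne : ε * ((C.submatrix id f).det * ψ ((fun i => Z i) ∘ f)) ≠ 0 := by
    have hinj : Function.Injective f := by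
      intro a b hab
      by_contra hne
      exact hf (det_zero_of_column_eq hne fun i => by simp [hab])
    obtain ⟨σ, hσ⟩ := exists_perm_strictMono hinj
    have hd : (C.submatrix id (f ∘ σ)).det ≠ 0 := by
      have h1 : (C.submatrix id (f ∘ σ)).det = ((Equiv.Perm.sign σ : ℤ) : ℝ) *
        (C.submatrix id f).det := det_permute' σ (C.submatrix id f)
      rw [h1]
      exact mul_ne_zero (by exact_mod_cast (Equiv.Perm.sign σ).ne_zero) hf
    rw [← det_mul_alternating_comp_perm ψ C _ f σ]
    refine mul_ne_zero ?_ (mul_ne_zero hd (hψ _ hσ).ne')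
    rcases hε with rfl | rfl <;> norm_num
  have hpos : 0 < ∑ f : Fin k → Fin n,
      ε * ((C.submatrix id f).det * ψ ((fun i => Z i) ∘ f)) :=
    sum_pos' (fun f _ => hnn f) ⟨f, mem_univ _, (hnn f).lt_of_ne' hfne⟩
  rw [← mul_sum, ← factorial_mul_alternating_mul] at hpos
  have hrow : (fun i => ∑ j, C i j • Z j) = (C * Z).row := by
    ext i l
    simp [mul_apply]
  by_contra hdep
  rw [hrow, ψ.map_linearDependent _ hdep] at hpos
  simp at hpos

lemma mulVec_injective_of_posMaxMinors {p n : ℕ} (hpn : p ≤ n)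
    {Z : Matrix (Fin n) (Fin p) ℝ} (hZ : posMaxMinors Z) : Function.Injective Z.mulVec := by
  have hcard : (univ.image (Fin.castLE hpn)).card = p := by
    rw [card_image_of_injective _ (Fin.castLE_injective hpn)]; simp
  have hdet := hZ _ hcard
  intro x y hxy
  refine mulVec_injective_of_isUnit ((isUnit_iff_isUnit_det _).2 hdet.ne'.isUnit) ?_
  funext t
  exact congrFun hxy _

lemma perpSub_inf_span_transpose {k n N : ℕ} (C : Matrix (Fin k) (Fin n) ℝ)
    (Z : Matrix (Fin n) (Fin N) ℝ) :
    perpSub (Submodule.span ℝ (Set.range (fun i => C i))) ⊓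
      Submodule.span ℝ (Set.range (fun j => (Matrix.transpose Z) j))
      = (LinearMap.ker (C * Z).mulVecLin).map Z.mulVecLin := by
  have hperp : ∀ w, w ∈ perpSub (Submodule.span ℝ (Set.range (fun i => C i))) ↔
      C *ᵥ w = 0 := by
    intro w
    constructor
    · intro h
      funext i
      exact h (C i) (Submodule.subset_span ⟨i, rfl⟩)
    · intro h v hv
      induction hv using Submodule.span_induction with
      | mem x hx =>
        obtain ⟨i, rfl⟩ := hx
        exact congrFun h i
      | zero => simp
      | add x y _ _ hx hy => simp [add_mul, sum_add_distrib, hx, hy]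
      | smul a x _ hx => simp [mul_assoc, ← mul_sum, hx]
  have hrange : Submodule.span ℝ (Set.range (fun j => Zᵀ j)) = LinearMap.range Z.mulVecLin :=
    (range_mulVecLin Z).symm
  rw [hrange]
  ext w
  rw [Submodule.mem_inf, hperp]
  constructor
  · rintro ⟨h, x, rfl⟩
    exact ⟨x, by simpa [mulVec_mulVec] using h, rfl⟩
  · rintro ⟨x, hx, rfl⟩
    exact ⟨by simpa [mulVec_mulVec] using hx, x, rfl⟩

/-- Stacking row bases of two complementary orthogonal subspaces, the determinants obtained by
completing one of them are proportional to the pairing determinants with the other. -/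
lemma exists_det_mul_transpose_eq_twist {k m : ℕ} {Y : Matrix (Fin k) (Fin (k + m)) ℝ}
    {F : Matrix (Fin m) (Fin (k + m)) ℝ} (hY : LinearIndependent ℝ Y.row)
    (hF : LinearIndependent ℝ F.row) (hYF : Y * Fᵀ = 0) :
    ∃ c : ℝ, c ≠ 0 ∧ ∀ U : Matrix (Fin m) (Fin (k + m)) ℝ,
      (F * Uᵀ).det = c * twist Y U := by
  have key : ∀ U : Matrix (Fin m) (Fin (k + m)) ℝ,
      twist Y U * twist Y F = (Y * Yᵀ).det * (F * Uᵀ).det := by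
    intro U
    have happ : ∀ U : Matrix (Fin m) (Fin (k + m)) ℝ,
        (of (Fin.append (fun i => Y i) U)).submatrix finSumFinEquiv id = fromRows Y U := by
      intro U
      ext i j
      rcases i with i | i
      · simpa using congrFun (Fin.append_left (fun i => Y i) U i) j
      · simpa using congrFun (Fin.append_right (fun i => Y i) U i) j
    have hprod : (of (Fin.append (fun i => Y i) U) *
        (of (Fin.append (fun i => Y i) F))ᵀ).submatrix finSumFinEquiv finSumFinEquiv
        = fromBlocks (Y * Yᵀ) 0 (U * Yᵀ) (U * Fᵀ) := by
      rw [← submatrix_mul_equiv _ _ _ (Equiv.refl _) _]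
      have h1 := happ U
      have h2 := happ F
      simp only [Equiv.coe_refl]
      rw [h1, ← transpose_submatrix, h2, transpose_fromRows, fromRows_mul_fromCols, hYF]
    have hdet := congrArg det hprod
    rw [det_submatrix_equiv_self, det_mul, det_transpose, det_fromBlocks_zero₁₂] at hdet
    rw [← det_transpose (F * Uᵀ), transpose_mul, transpose_transpose]
    exact hdet
  have hYY := det_mul_transpose_self_ne_zero hY
  have hN : twist Y F ≠ 0 := by
    intro h
    have := key F
    rw [h, mul_zero] at this
    exact mul_ne_zero hYY (det_mul_transpose_self_ne_zero hF) this.symm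
  refine ⟨twist Y F / (Y * Yᵀ).det, div_ne_zero hN hYY, fun U => ?_⟩
  rw [div_mul_eq_mul_div, eq_div_iff hYY, mul_comm (twist Y F), key U, mul_comm]

/-- The Pluecker coordinates of `X = V^⊥ ∩ W` agree, up to a common nonzero
scalar, with the twistor coordinates of `Y = Z~(V)`; moreover `X` has
dimension `m`. -/
theorem stmt6 (k m n : ℕ) (hkm : k + m ≤ n)
    (Z : Matrix (Fin n) (Fin (k + m)) ℝ) (hZ : posMaxMinors Z)
    (W : Submodule ℝ (Fin n → ℝ))
    (hW : W = Submodule.span ℝ (Set.range (fun j => (Matrix.transpose Z) j)))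
    (C : Matrix (Fin k) (Fin n) ℝ)
    (hC : LinearIndependent ℝ (fun i => C i))
    (hCnn : ∃ ε : ℝ, (ε = 1 ∨ ε = -1) ∧
      ∀ (S : Finset (Fin n)) (h : S.card = k), 0 ≤ ε * pluck C S h) :
    Module.finrank ℝ
      ↥(perpSub (Submodule.span ℝ (Set.range (fun i => C i))) ⊓ W) = m ∧
    ∀ D : Matrix (Fin m) (Fin n) ℝ,
      LinearIndependent ℝ (fun i => D i) →
      Submodule.span ℝ (Set.range (fun i => D i)) =
        perpSub (Submodule.span ℝ (Set.range (fun i => C i))) ⊓ W →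
      ∀ Y : Matrix (Fin k) (Fin (k + m)) ℝ,
        LinearIndependent ℝ (fun i => Y i) →
        Submodule.span ℝ (Set.range (fun i => Y i)) =
          Submodule.span ℝ (Set.range (fun i => (C * Z) i)) →
        ∃ c : ℝ, c ≠ 0 ∧
          ∀ (I : Finset (Fin n)) (hI : I.card = m),
            pluck D I hI = c * twist Y (fun t => Z ((I.orderIsoOfFin hI t).val)) := by
  subst hW
  rw [perpSub_inf_span_transpose]
  have hA : LinearIndependent ℝ (C * Z).row :=
    linearIndependent_mul_of_posMaxMinors hkm hZ hC hCnn
  have hZinj := mulVec_injective_of_posMaxMinors hkm hZ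
  constructor
  · rw [← (Submodule.equivMapOfInjective Z.mulVecLin hZinj _).finrank_eq]
    have h1 := (C * Z).mulVecLin.finrank_range_add_finrank_ker
    have h2 : Module.finrank ℝ (LinearMap.range (C * Z).mulVecLin) = k := by
      simpa [Matrix.rank] using hA.rank_matrix
    rw [h2] at h1
    simpa using h1
  · intro D hD hDX Y hY hYA
    have hmem : ∀ i, ∃ x : Fin (k + m) → ℝ, (C * Z) *ᵥ x = 0 ∧ Z *ᵥ x = D i := by
      intro i
      have h : D i ∈ Submodule.span ℝ (Set.range fun i => D i) := Submodule.subset_span ⟨i, rfl⟩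
      rw [hDX] at h
      obtain ⟨x, hx, hxD⟩ := h
      exact ⟨x, by simpa using hx, hxD⟩
    choose F hF0 hFD using hmem
    have hF : LinearIndependent ℝ (fun i => F i) := by
      refine LinearIndependent.of_comp Z.mulVecLin ?_
      convert hD using 2 with i
      exact hFD i
    have hYF : Y * (of F)ᵀ = 0 := by
      have h : ∀ i j, Y i ⬝ᵥ F j = 0 := by
        intro i j
        have hi : Y i ∈ Submodule.span ℝ (Set.range fun i => (C * Z) i) :=
          hYA ▸ Submodule.subset_span ⟨i, rfl⟩
        generalize Y i = v at hi
        induction hi using Submodule.span_induction with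
        | mem x hx =>
          obtain ⟨l, rfl⟩ := hx
          exact congrFun (hF0 j) l
        | zero => simp
        | add x y _ _ hx hy => rw [add_dotProduct, hx, hy, add_zero]
        | smul a x _ hx => rw [smul_dotProduct, hx, smul_zero]
      ext i j
      exact h i j
    obtain ⟨c, hc, hdet⟩ := exists_det_mul_transpose_eq_twist (F := of F) hY hF hYF
    refine ⟨c, hc, fun I hI => ?_⟩
    refine Eq.trans ?_ (hdet (of fun t => Z ((I.orderIsoOfFin hI t).val)))
    rw [pluck]
    congr 1
    ext i t
    rw [submatrix_apply, id_eq, ← hFD i, mul_apply, mulVec, dotProduct]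
    exact sum_congr rfl fun l _ => mul_comm _ _
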